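/- For every fixed integer s ≥ 1, the s-th factorial moment of X_n satisfies E(X_n·(X_n−1)·…·(X_n−s+1)) / n^{s/2} → μ̃_s as n → ∞, where E(X_n·(X_n−1)·…·(X_n−s+1)) = (1/2^n)·Σ_{k≥0} k·(k−1)·…·(k−s+1)·[q^k] f_n(q). -/

import Mathlib

/-- The polynomials `g_{m1,m2}(q)` defined by the recurrence
`g_{m1,m2}(q) = q^{δ(c,m1)} g_{m1-1,m2}(q) + g_{m1,m2-1}(q)` with `c = ⌊(m1+m2)/2⌋+1`,
`g_{0,0} = 1` and `g` vanishing for negative indices. -/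
noncomputable def gP : ℕ → ℕ → Polynomial ℝ
  | 0, 0 => 1
  | 0, m2 + 1 => gP 0 m2
  | m1 + 1, 0 =>
      Polynomial.X ^ (if (m1 + 1) / 2 + 1 = m1 + 1 then 1 else 0) * gP m1 0
  | m1 + 1, m2 + 1 =>
      Polynomial.X ^ (if (m1 + 1 + (m2 + 1)) / 2 + 1 = m1 + 1 then 1 else 0) * gP m1 (m2 + 1)
        + gP (m1 + 1) m2

/-- `P(t) = (1 - √(1-4t))/2`, the generating function of shifted Catalan numbers. -/
noncomputable def Pgf (t : ℝ) : ℝ := (1 - Real.sqrt (1 - 4 * t)) / 2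

/-- The generating function `f_n(q)` of the number of correct guesses `X_n`:
`P(X_n = k) = [q^k] f_n(q) / 2^n`, with `h = ⌈n/2⌉`. -/
noncomputable def fP (n : ℕ) : Polynomial ℝ :=
  4 * Polynomial.X ^ 4 - 2 * (Polynomial.X ^ 2 + Polynomial.X ^ 3) +
    ∑ a ∈ Finset.range ((n + 1) / 2 + 1), ∑ b ∈ Finset.range (n - (n + 1) / 2 + 1),
      gP a ((n + 1) / 2 - a) * gP b (n - (n + 1) / 2 - b)

/-- The moments `μ̃_s` of the sum of two independent half-normal random variables. -/
noncomputable def mutilde (s : ℕ) : ℝ :=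
  ∑ k ∈ Finset.range (s + 1),
    (s.choose k : ℝ) * Real.Gamma (((k : ℝ) + 1) / 2) * Real.Gamma (((s : ℝ) - (k : ℝ) + 1) / 2)
      / Real.pi

/-- The quotient `(a+1)(a+2)⋯(a+n) / n!`. -/
noncomputable def riseQuot (a : ℝ) (n : ℕ) : ℝ := ∏ i ∈ Finset.range n, (a + 1 + i) / (i + 1)

lemma riseQuot_zero_right (a : ℝ) : riseQuot a 0 = 1 := by simp [riseQuot]

lemma riseQuot_succ (a : ℝ) (n : ℕ) :
    riseQuot a (n + 1) = riseQuot a n * ((a + 1 + n) / (n + 1)) := by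
  rw [riseQuot, Finset.prod_range_succ, riseQuot]

lemma riseQuot_zero_left (n : ℕ) : riseQuot 0 n = 1 := by
  refine Finset.prod_eq_one fun i _ => ?_
  have : (i : ℝ) + 1 ≠ 0 := by positivity
  field_simp
  ring

lemma riseQuot_sub_one_succ (a : ℝ) (n : ℕ) :
    riseQuot (a - 1) (n + 1) = a / (n + 1) * riseQuot a n := by
  induction n with
  | zero => simp [riseQuot]
  | succ n ih =>
    rw [riseQuot_succ, ih, riseQuot_succ a n]
    have : (n : ℝ) + 1 ≠ 0 := by positivity
    have : (n : ℝ) + 1 + 1 ≠ 0 := by positivity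
    push_cast
    field_simp
    ring

lemma riseQuot_succ_sub (a : ℝ) (n : ℕ) :
    riseQuot a (n + 1) - riseQuot a n = riseQuot (a - 1) (n + 1) := by
  rw [riseQuot_sub_one_succ, riseQuot_succ]
  have : (n : ℝ) + 1 ≠ 0 := by positivity
  field_simp
  ring

/-- The power series `(1 + X) (1 - X²)^(-(a+1))`. -/
noncomputable def riseSeries (a : ℝ) : PowerSeries ℝ :=
  PowerSeries.mk fun m => riseQuot a (m / 2)

/-- The power series `(1 - X²)^(-1/2)`. -/
noncomputable def rootSeries : PowerSeries ℝ := (1 - PowerSeries.X) * riseSeries (1 / 2)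

section Series

open PowerSeries

lemma one_sub_X_sq_mul_riseSeries (a : ℝ) :
    (1 - X ^ 2) * riseSeries a = riseSeries (a - 1) := by
  ext m
  rw [sub_mul, one_mul, map_sub]
  match m with
  | 0 => simp [riseSeries, riseQuot_zero_right]
  | 1 => simp [riseSeries, riseQuot_zero_right, coeff_X_pow_mul']
  | m + 2 =>
    rw [coeff_X_pow_mul]
    simp only [riseSeries, coeff_mk]
    rw [show (m + 2) / 2 = m / 2 + 1 by omega]
    exact riseQuot_succ_sub a _

lemma one_sub_X_mul_riseSeries_zero : (1 - X) * riseSeries 0 = 1 := by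
  ext m
  rw [sub_mul, one_mul, map_sub]
  cases m with
  | zero => simp [riseSeries, riseQuot_zero_right]
  | succ m => simp [riseSeries, riseQuot_zero_left, coeff_succ_X_mul, coeff_one]

lemma coeff_rootSeries_zero : coeff 0 rootSeries = 1 := by
  simp [rootSeries, riseSeries, riseQuot_zero_right]

lemma coeff_rootSeries_one : coeff 1 rootSeries = 0 := by
  rw [rootSeries, sub_mul, one_mul, map_sub, ← zero_add 1, coeff_succ_X_mul]
  simp [riseSeries]

lemma coeff_rootSeries_add_two (m : ℕ) :
    (m + 2 : ℝ) * coeff (m + 2) rootSeries = (m + 1) * coeff m rootSeries := by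
  have key : ∀ n : ℕ, coeff (n + 1) rootSeries
      = riseQuot (1 / 2) ((n + 1) / 2) - riseQuot (1 / 2) (n / 2) := fun n => by
    rw [rootSeries, sub_mul, one_mul, map_sub, coeff_succ_X_mul]
    simp [riseSeries]
  rw [key (m + 1)]
  rcases Nat.even_or_odd' m with ⟨k, rfl | rfl⟩
  · rw [show (2 * k + 1 + 1) / 2 = k + 1 by omega, show (2 * k + 1) / 2 = k by omega,
      riseQuot_succ_sub, riseQuot_succ]
    have h : coeff (2 * k) rootSeries = riseQuot (1 / 2 - 1) k := by
      cases k with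
      | zero => rw [mul_zero, coeff_rootSeries_zero, riseQuot_zero_right]
      | succ k =>
        rw [show 2 * (k + 1) = 2 * k + 1 + 1 by ring, key,
          show (2 * k + 1 + 1) / 2 = k + 1 by omega, show (2 * k + 1) / 2 = k by omega,
          riseQuot_succ_sub]
    rw [h]
    have : (k : ℝ) + 1 ≠ 0 := by positivity
    push_cast
    field_simp
    ring
  · rw [key, show (2 * k + 1 + 1 + 1) / 2 = k + 1 by omega,
      show (2 * k + 1 + 1) / 2 = k + 1 by omega, show (2 * k + 1) / 2 = k by omega,
      show 2 * k / 2 = k by omega]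
    simp

lemma one_sub_X_sq_mul_derivative_rootSeries :
    (1 - X ^ 2) * derivative ℝ rootSeries = X * rootSeries := by
  ext m
  rw [sub_mul, one_mul, map_sub]
  match m with
  | 0 =>
    rw [coeff_derivative, zero_add, coeff_rootSeries_one]
    simp
  | 1 =>
    have h := coeff_rootSeries_add_two 0
    rw [coeff_derivative, coeff_X_pow_mul', ← zero_add 1, coeff_succ_X_mul]
    norm_num at h ⊢
    linarith
  | m + 2 =>
    have h := coeff_rootSeries_add_two (m + 1)
    rw [coeff_X_pow_mul, coeff_derivative, coeff_derivative,
      show m + 2 = (m + 1) + 1 by ring, coeff_succ_X_mul]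
    rw [show m + 1 + 1 + 1 = m + 1 + 2 by ring]
    push_cast at h ⊢
    linarith

lemma rootSeries_sq_mul : rootSeries ^ 2 * (1 - X ^ 2) = 1 := by
  refine derivative.ext ?_ ?_
  · rw [Derivation.leibniz, Derivation.leibniz_pow]
    simp only [map_sub, Derivation.leibniz_pow, derivative_one, derivative_X, smul_eq_mul,
      nsmul_eq_mul, Nat.cast_ofNat, pow_one, mul_one, zero_sub, Nat.add_one_sub_one]
    linear_combination (2 * rootSeries) * one_sub_X_sq_mul_derivative_rootSeries
  · have h : constantCoeff rootSeries = 1 := by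
      rw [← coeff_zero_eq_constantCoeff_apply, coeff_rootSeries_zero]
    simp [h]

lemma rootSeries_pow_mul_riseSeries_zero (j : ℕ) :
    rootSeries ^ j * riseSeries 0 = riseSeries (j / 2) := by
  induction j using Nat.twoStepInduction with
  | zero => simp
  | one =>
    rw [rootSeries]
    push_cast
    linear_combination riseSeries (1 / 2) * one_sub_X_mul_riseSeries_zero
  | more j ih _ =>
    have h := one_sub_X_sq_mul_riseSeries ((j : ℝ) / 2 + 1)
    rw [add_sub_cancel_right, ← ih] at h
    rw [show ((j + 2 : ℕ) : ℝ) / 2 = j / 2 + 1 by push_cast; ring]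
    linear_combination (-rootSeries ^ 2) * h + riseSeries (j / 2 + 1) * rootSeries_sq_mul

/-- The generating function of the first passage of a simple random walk to an adjacent site. -/
lemma exists_passage_series : ∃ φ : PowerSeries ℝ,
    2 * φ = X * (1 + φ ^ 2) ∧ rootSeries * (1 - X * φ) = 1 ∧
      X * φ = 1 - (1 - X ^ 2) * rootSeries := by
  have h0 : constantCoeff rootSeries = 1 := by
    rw [← coeff_zero_eq_constantCoeff_apply, coeff_rootSeries_zero]
  obtain ⟨φ, hφ⟩ : X ∣ 1 - (1 - X ^ 2) * rootSeries := by
    rw [X_dvd_iff]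
    simp [h0]
  refine ⟨φ, ?_, ?_, hφ.symm⟩
  · have hX : (X : PowerSeries ℝ) ≠ 0 := X_ne_zero
    refine mul_left_cancel₀ hX ?_
    linear_combination (-1 + X * φ - (1 - X ^ 2) * rootSeries) * hφ
      - (1 - X ^ 2) * rootSeries_sq_mul
  · linear_combination rootSeries * hφ + rootSeries_sq_mul

end Series

section Asymptotics

open PowerSeries Filter Topology

/-- The coefficients of `F` are asymptotically `c * m ^ e`. -/
def CoeffAsymp (F : PowerSeries ℝ) (e c : ℝ) : Prop :=
  Tendsto (fun m : ℕ => coeff m F / (m : ℝ) ^ e) atTop (𝓝 c)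

namespace CoeffAsymp

variable {F G : PowerSeries ℝ} {e e' c c' : ℝ}

lemma sub (hF : CoeffAsymp F e c) (hG : CoeffAsymp G e c') : CoeffAsymp (F - G) e (c - c') := by
  refine (Tendsto.sub hF hG).congr fun m => ?_
  rw [map_sub, sub_div]

lemma smul (r : ℝ) (hF : CoeffAsymp F e c) : CoeffAsymp (r • F) e (r * c) := by
  refine (Tendsto.const_mul r hF).congr fun m => ?_
  simp [mul_div_assoc]

lemma of_lt (h : e < e') (hF : CoeffAsymp F e c) : CoeffAsymp F e' 0 := by
  have h1 : Tendsto (fun m : ℕ => (m : ℝ) ^ (-(e' - e))) atTop (𝓝 0) :=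
    (tendsto_rpow_neg_atTop (sub_pos.2 h)).comp tendsto_natCast_atTop_atTop
  have h2 := Tendsto.mul hF h1
  rw [mul_zero] at h2
  refine h2.congr' ?_
  filter_upwards [eventually_gt_atTop 0] with m hm
  have hm' : (0 : ℝ) < m := by exact_mod_cast hm
  rw [show -(e' - e) = e - e' by ring, Real.rpow_sub hm']
  have := (Real.rpow_pos_of_pos hm' e).ne'
  field_simp

lemma tendsto_succ_rpow_div (e : ℝ) :
    Tendsto (fun m : ℕ => ((m + 1 : ℕ) : ℝ) ^ e / (m : ℝ) ^ e) atTop (𝓝 1) := by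
  have h1 : Tendsto (fun m : ℕ => 1 + 1 / (m : ℝ)) atTop (𝓝 1) := by
    simpa using (tendsto_one_div_atTop_nhds_zero_nat (𝕜 := ℝ)).const_add 1
  have h2 := h1.rpow_const (p := e) (Or.inl one_ne_zero)
  rw [Real.one_rpow] at h2
  refine h2.congr' ?_
  filter_upwards [eventually_gt_atTop 0] with m hm
  have hm' : (0 : ℝ) < m := by exact_mod_cast hm
  rw [← Real.div_rpow (by positivity) hm'.le]
  congr 1
  push_cast
  field_simp

lemma of_X_mul (hF : CoeffAsymp (X * F) e c) : CoeffAsymp F e c := by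
  have h := ((tendsto_add_atTop_iff_nat 1).2 hF).mul (tendsto_succ_rpow_div e)
  rw [mul_one] at h
  refine h.congr fun m => ?_
  have : (0 : ℝ) < ((m + 1 : ℕ) : ℝ) ^ e := by positivity
  rw [coeff_succ_X_mul]
  field_simp

lemma X_mul (hF : CoeffAsymp F e c) : CoeffAsymp (X * F) e c := by
  have h := hF.mul ((tendsto_succ_rpow_div e).inv₀ one_ne_zero)
  rw [inv_one, mul_one] at h
  refine (tendsto_add_atTop_iff_nat 1).1 (h.congr' ?_)
  filter_upwards [eventually_gt_atTop 0] with m hm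
  have hm' : (0 : ℝ) < m := by exact_mod_cast hm
  have := Real.rpow_pos_of_pos hm' e
  rw [coeff_succ_X_mul]
  field_simp

lemma one_sub_X_mul (hF : CoeffAsymp F e c) : CoeffAsymp ((1 - X) * F) e 0 := by
  rw [sub_mul, one_mul, ← sub_self c]
  exact hF.sub hF.X_mul

end CoeffAsymp

lemma tendsto_riseQuot {a : ℝ} (ha : 0 ≤ a) :
    Tendsto (fun n : ℕ => riseQuot a n / (n : ℝ) ^ a) atTop (𝓝 (1 / Real.Gamma (a + 1))) := by
  have hΓ : Real.Gamma (a + 1) ≠ 0 := (Real.Gamma_pos_of_pos (by linarith)).ne'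
  have h1 := (Real.GammaSeq_tendsto_Gamma (a + 1)).inv₀ hΓ
  have h2 := tendsto_natCast_div_add_atTop (a + 1)
  have h3 := h2.mul h1
  rw [one_mul, inv_eq_one_div] at h3
  refine h3.congr' ?_
  filter_upwards [eventually_gt_atTop 0] with n hn
  have hn' : (0 : ℝ) < n := by exact_mod_cast hn
  have hpos := Real.rpow_pos_of_pos hn' a
  have hprod : (0 : ℝ) < ∏ j ∈ Finset.range n, (a + 1 + j) :=
    Finset.prod_pos fun i _ => by positivity
  have hfac : (∏ j ∈ Finset.range n, ((j : ℝ) + 1)) = (n.factorial : ℝ) := by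
    rw [← Finset.prod_range_add_one_eq_factorial]
    push_cast
    rfl
  have hf : (0 : ℝ) < n.factorial := by positivity
  rw [Real.GammaSeq, riseQuot, Finset.prod_div_distrib, hfac, Finset.prod_range_succ,
    Real.rpow_add_one hn'.ne']
  have : (0 : ℝ) < a + 1 + n := by positivity
  field_simp
  ring

lemma tendsto_half_div : Tendsto (fun m : ℕ => ((m / 2 : ℕ) : ℝ) / m) atTop (𝓝 (1 / 2)) := by
  have h := (tendsto_nat_floor_mul_div_atTop (R := ℝ) (a := 1 / 2) (by norm_num)).comp
    tendsto_natCast_atTop_atTop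
  refine h.congr fun m => ?_
  simp only [Function.comp]
  rw [← Nat.floor_div_eq_div (K := ℝ), one_div_mul_eq_div]
  norm_num

lemma coeffAsymp_riseSeries {a : ℝ} (ha : 0 ≤ a) :
    CoeffAsymp (riseSeries a) a ((1 / 2) ^ a / Real.Gamma (a + 1)) := by
  have hdiv : Tendsto (fun m : ℕ => m / 2) atTop atTop :=
    Nat.tendsto_div_const_atTop (by norm_num)
  have h1 := (tendsto_riseQuot ha).comp hdiv
  have h2 := tendsto_half_div.rpow_const (p := a) (Or.inl (by norm_num))
  have h3 := h1.mul h2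
  rw [one_div_mul_eq_div] at h3
  refine h3.congr' ?_
  filter_upwards [eventually_ge_atTop 2] with m hm
  have hm' : (0 : ℝ) < m := by exact_mod_cast (by omega : 0 < m)
  have hm2 : (0 : ℝ) < (m / 2 : ℕ) := by exact_mod_cast (by omega : 0 < m / 2)
  have := Real.rpow_pos_of_pos hm2 a
  have := Real.rpow_pos_of_pos hm' a
  simp only [Function.comp, riseSeries, coeff_mk]
  rw [Real.div_rpow hm2.le hm'.le]
  field_simp

/-- The limit of `E[C(X, k)] / m ^ (k/2)` for a walk of length `m`. -/
noncomputable def limitConst (k : ℕ) : ℝ := (1 / 2) ^ ((k : ℝ) / 2) / Real.Gamma ((k : ℝ) / 2 + 1)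

lemma coeffAsymp_rootSeries_pow (j i : ℕ) :
    CoeffAsymp (rootSeries ^ j * (rootSeries - 1) ^ i * riseSeries 0) (((j + i : ℕ) : ℝ) / 2)
      (limitConst (j + i)) := by
  induction i generalizing j with
  | zero =>
    rw [pow_zero, mul_one, rootSeries_pow_mul_riseSeries_zero]
    exact coeffAsymp_riseSeries (by positivity)
  | succ i ih =>
    have h1 := ih (j + 1)
    have h2 : CoeffAsymp _ (((j + 1 + i : ℕ) : ℝ) / 2) 0 :=
      (ih j).of_lt (by push_cast; linarith)
    have h3 := h1.sub h2
    rw [sub_zero] at h3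
    rw [show j + (i + 1) = j + 1 + i by ring]
    convert h3 using 1
    ring

/-- Main term and lower order corrections of the marked generating functions. -/
lemma coeffAsymp_marked (k : ℕ) :
    CoeffAsymp (rootSeries * (rootSeries - 1) ^ k * riseSeries 0
      - (1 / 2 : ℝ) • ((rootSeries - 1) ^ k * riseSeries 0)
      - (1 / 2 : ℝ) • ((1 - X) * (rootSeries * (rootSeries - 1) ^ k * riseSeries 0)))
      (((k + 1 : ℕ) : ℝ) / 2) (limitConst (k + 1)) := by
  have h1 := coeffAsymp_rootSeries_pow 1 k
  have h2 := coeffAsymp_rootSeries_pow 0 k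
  rw [pow_one, add_comm 1 k] at h1
  rw [pow_zero, one_mul, zero_add] at h2
  have h4 : CoeffAsymp _ (((k + 1 : ℕ) : ℝ) / 2) 0 := h2.of_lt (by push_cast; linarith)
  simpa using (h1.sub (h4.smul (1 / 2))).sub (h1.one_sub_X_mul.smul (1 / 2))

end Asymptotics

section Walk

open Polynomial in
/-- The weight of an up step arriving at `x`, in the variable `X = q - 1`. -/
noncomputable def stepWeight (x : ℤ) : Polynomial ℝ := if x = 1 ∨ x = 2 then 1 + X else 1

open Polynomial in
/-- The normalised weighted number of walks of length `m` from `0` to `x`. -/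
noncomputable def walkPoly : ℕ → ℤ → Polynomial ℝ
  | 0, x => if x = 0 then 1 else 0
  | m + 1, x => C (1 / 2) * (stepWeight x * walkPoly m (x - 1) + walkPoly m (x + 1))

lemma walkPoly_eq_zero_of_lt (m : ℕ) (x : ℤ) (h : (m : ℤ) < |x|) : walkPoly m x = 0 := by
  induction m generalizing x with
  | zero => simp_all [walkPoly]
  | succ m ih =>
    rw [walkPoly, ih, ih]
    · simp
    all_goals push_cast at h; grind

lemma walkPoly_eq_zero_of_odd (m : ℕ) (x : ℤ) (h : Odd (m + x)) : walkPoly m x = 0 := by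
  induction m generalizing x with
  | zero =>
    have : x ≠ 0 := by rintro rfl; simp at h
    simp [walkPoly, this]
  | succ m ih =>
    rw [walkPoly, ih, ih]
    · simp
    all_goals push_cast at h; rw [Int.odd_iff] at h ⊢; omega

/-- The normalised weighted number of all walks of length `m`. -/
noncomputable def walkTotal (m : ℕ) : Polynomial ℝ :=
  ∑ a ∈ Finset.range (m + 1), walkPoly m (2 * a - m)

open Polynomial in
lemma taylor_gP (a b : ℕ) :
    taylor 1 (gP a b) = C (2 ^ (a + b)) * walkPoly (a + b) ((a : ℤ) - b) := by
  have hC : ∀ n : ℕ, (C (2 ^ (n + 1)) : ℝ[X]) * C (1 / 2) = C (2 ^ n) := fun n => by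
    rw [← C_mul]; congr 1; ring
  have hX : ∀ i : ℕ, taylor (1 : ℝ) (X ^ i) = (1 + X) ^ i := fun i => by
    rw [taylor_X_pow, C_1, add_comm]
  have key : ∀ a b : ℕ, (1 + X : ℝ[X]) ^ (if (a + 1 + b) / 2 + 1 = a + 1 then 1 else 0)
      = stepWeight ((a + 1 : ℕ) - b) := fun a b => by
    have : (a + 1 + b) / 2 + 1 = a + 1 ↔
        ((a + 1 : ℕ) : ℤ) - b = 1 ∨ ((a + 1 : ℕ) : ℤ) - b = 2 := by omega
    rw [stepWeight]
    simp only [this]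
    split_ifs <;> simp
  fun_induction gP a b with
  | case1 => simp [walkPoly]
  | case2 b ih =>
    have h0 : walkPoly (0 + b) (((0 : ℕ) : ℤ) - (b + 1 : ℕ) - 1) = 0 :=
      walkPoly_eq_zero_of_lt _ _ (lt_abs.2 (Or.inr (by push_cast; omega)))
    rw [ih, Nat.succ_eq_add_one, show 0 + (b + 1) = 0 + b + 1 by omega, walkPoly, ← mul_assoc, hC,
      h0, mul_zero,
      show ((0 : ℕ) : ℤ) - (b + 1 : ℕ) + 1 = (0 : ℕ) - b by push_cast; ring]
    simp only [zero_add]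
  | case3 a ih =>
    have h0 : walkPoly a ((a : ℤ) + 1 + 1) = 0 :=
      walkPoly_eq_zero_of_lt _ _ (lt_abs.2 (Or.inl (by omega)))
    have hk : (1 + X : ℝ[X]) ^ (if (a + 1) / 2 + 1 = a + 1 then 1 else 0)
      = stepWeight ((a : ℤ) + 1) := by simpa using key a 0
    have hx : ((a.succ : ℕ) : ℤ) - (0 : ℕ) = (a : ℤ) + 1 := by push_cast; ring
    have ha : a.succ + 0 = a + 1 := rfl
    simp only [add_zero, CharP.cast_eq_zero, sub_zero] at ih
    rw [taylor_mul, hX, ih, hk, hx, ha, walkPoly, ← mul_assoc (C _), hC, add_sub_cancel_right, h0]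
    ring
  | case4 a b ih1 ih2 =>
    have hx : ((a + 1 : ℕ) : ℤ) - (b + 1 : ℕ) - 1 = a - (b + 1 : ℕ) := by push_cast; ring
    have hy : ((a + 1 : ℕ) : ℤ) - (b + 1 : ℕ) + 1 = (a + 1 : ℕ) - b := by push_cast; ring
    have hm : a + 1 + b = a + (b + 1) := by ring
    have hn : a.succ + b.succ = a + (b + 1) + 1 := by omega
    rw [hm] at ih2
    rw [map_add, taylor_mul, hX, ih1, ih2, key, hn, walkPoly, ← mul_assoc (C _), hC]
    simp only [Nat.succ_eq_add_one]
    rw [hx, hy]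
    ring

open Polynomial in
lemma taylor_sum_gP (m : ℕ) :
    taylor 1 (∑ a ∈ Finset.range (m + 1), gP a (m - a)) = C (2 ^ m) * walkTotal m := by
  rw [map_sum, walkTotal, Finset.mul_sum]
  refine Finset.sum_congr rfl fun a ha => ?_
  have ha' : a ≤ m := by simpa [Nat.lt_succ_iff] using ha
  rw [taylor_gP, Nat.add_sub_cancel' ha']
  congr 2
  push_cast [ha']
  ring

open Polynomial in
lemma walkTotal_succ (m : ℕ) :
    walkTotal (m + 1) = walkTotal m + C (1 / 2) * X * (walkPoly m 0 + walkPoly m 1) := by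
  have hhalf : (C (1 / 2) : ℝ[X]) * 2 = 1 := by
    rw [← C_ofNat, ← C_mul]; norm_num
  have hmark : ∑ a ∈ Finset.range (m + 1),
      (if (2 * a - m + 1 : ℤ) = 1 ∨ (2 * a - m + 1 : ℤ) = 2 then walkPoly m (2 * a - m) else 0)
        = walkPoly m 0 + walkPoly m 1 := by
    rcases Nat.even_or_odd' m with ⟨j, rfl | rfl⟩
    · rw [Finset.sum_eq_single j, walkPoly_eq_zero_of_odd _ 1 (by simp)]
      · simp
      · intro b _ hb
        rw [if_neg]
        push_cast
        omega
      · simp only [Finset.mem_range]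
        omega
    · rw [Finset.sum_eq_single (j + 1), walkPoly_eq_zero_of_odd _ 0 (by simp)]
      · push_cast
        rw [show (2 * ((j : ℤ) + 1) - (2 * j + 1)) = 1 by ring]
        simp
      · intro b _ hb
        rw [if_neg]
        push_cast
        omega
      · simp only [Finset.mem_range]
        omega
  have hup : ∑ a ∈ Finset.range (m + 2), stepWeight (2 * a - (m + 1 : ℕ)) *
      walkPoly m (2 * a - (m + 1 : ℕ) - 1)
        = walkTotal m + X * (walkPoly m 0 + walkPoly m 1) := by
    rw [Finset.sum_range_succ', walkPoly_eq_zero_of_lt m _ (by push_cast; grind), mul_zero,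
      add_zero, ← hmark, walkTotal, Finset.mul_sum, ← Finset.sum_add_distrib]
    refine Finset.sum_congr rfl fun a _ => ?_
    rw [show (2 * ((a + 1 : ℕ) : ℤ) - (m + 1 : ℕ)) = 2 * a - m + 1 by push_cast; ring,
      add_sub_cancel_right, stepWeight]
    split_ifs <;> ring
  have hdown : ∑ a ∈ Finset.range (m + 2), walkPoly m (2 * a - (m + 1 : ℕ) + 1)
      = walkTotal m := by
    rw [Finset.sum_range_succ, walkPoly_eq_zero_of_lt m _ (by push_cast; grind), add_zero,
      walkTotal]
    refine Finset.sum_congr rfl fun a _ => ?_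
    congr 1
    push_cast
    ring
  have h : walkTotal (m + 1) = C (1 / 2) *
      (walkTotal m + X * (walkPoly m 0 + walkPoly m 1) + walkTotal m) := by
    have hdef : walkTotal (m + 1) = ∑ a ∈ Finset.range (m + 2), C (1 / 2) *
        (stepWeight (2 * a - (m + 1 : ℕ)) * walkPoly m (2 * a - (m + 1 : ℕ) - 1)
          + walkPoly m (2 * a - (m + 1 : ℕ) + 1)) := rfl
    rw [hdef, ← Finset.mul_sum, Finset.sum_add_distrib, hup, hdown]
  rw [h]
  linear_combination walkTotal m * hhalf

end Walk

section Bivariate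

open PowerSeries

/-- The generating function of walks from `0` to `x`. -/
noncomputable def posSeries (x : ℤ) : PowerSeries (Polynomial ℝ) :=
  PowerSeries.mk fun m => walkPoly m x

/-- The generating function of all walks. -/
noncomputable def totalSeries : PowerSeries (Polynomial ℝ) := PowerSeries.mk walkTotal

/-- The series `X / 2`, the weight of a single step. -/
noncomputable def halfX : PowerSeries ℝ := (1 / 2 : ℝ) • X

lemma two_mul_halfX : 2 * halfX = X := by
  rw [halfX, two_mul, ← add_smul]
  norm_num

lemma map_halfX : PowerSeries.map Polynomial.C halfX
    = X * C (Polynomial.C (1 / 2 : ℝ)) := by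
  rw [halfX, smul_eq_C_mul, map_mul, map_C, map_X, mul_comm]

lemma posSeries_eq (x : ℤ) :
    posSeries x = (if x = 0 then 1 else 0) + PowerSeries.map Polynomial.C halfX *
      (C (stepWeight x) * posSeries (x - 1) + posSeries (x + 1)) := by
  rw [map_halfX]
  ext1 m
  rw [mul_assoc, map_add]
  cases m with
  | zero =>
    rw [coeff_zero_X_mul, add_zero]
    split_ifs with h <;> simp [posSeries, walkPoly, h]
  | succ m =>
    rw [coeff_succ_X_mul, coeff_C_mul, map_add, coeff_C_mul]
    split_ifs with h <;> simp [posSeries, walkPoly, coeff_one]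

lemma one_sub_X_mul_totalSeries :
    (1 - X) * totalSeries = 1 + C Polynomial.X * (PowerSeries.map Polynomial.C halfX *
      (posSeries 0 + posSeries 1)) := by
  rw [map_halfX]
  ext1 m
  rw [sub_mul, one_mul, map_sub, map_add, coeff_C_mul, mul_assoc X]
  cases m with
  | zero => simp [totalSeries, walkTotal, walkPoly]
  | succ m =>
    rw [coeff_succ_X_mul, coeff_succ_X_mul, coeff_C_mul, totalSeries, coeff_mk, coeff_mk,
      walkTotal_succ]
    simp [posSeries, coeff_one]
    ring

lemma eq_zero_of_eq_X_mul {K : Type*} [CommRing K] (F A B : ℤ → PowerSeries K)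
    (h : ∀ x, F x = X * (A x * F (x - 1) + B x * F (x + 1))) (x : ℤ) : F x = 0 := by
  have key : ∀ m x, ∀ i ≤ m, coeff i (F x) = 0 := by
    intro m
    induction m with
    | zero =>
      intro x i hi
      rw [Nat.le_zero.1 hi, h, coeff_zero_X_mul]
    | succ m ih =>
      intro x i hi
      rw [h]
      cases i with
      | zero => rw [coeff_zero_X_mul]
      | succ i =>
        have hmul : ∀ a y, coeff i (a * F y) = 0 := fun a y => by
          rw [coeff_mul]
          refine Finset.sum_eq_zero fun p hp => ?_
          have := Finset.HasAntidiagonal.mem_antidiagonal.1 hp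
          rw [ih y p.2 (by omega), mul_zero]
        rw [coeff_succ_X_mul, map_add, hmul, hmul, add_zero]
  ext1 m
  simpa using key m x m le_rfl

/-- Closed form of `posSeries`, multiplied by its denominator. -/
noncomputable def posNumerator (φ z q : PowerSeries (Polynomial ℝ)) (x : ℤ) :
    PowerSeries (Polynomial ℝ) :=
  if x ≤ 0 then (1 + φ ^ 2) * (1 - z * q * φ) * φ ^ (-x).toNat
  else if x = 1 then q * φ else q ^ 2 * φ ^ x.toNat

lemma posNumerator_neg (φ z q : PowerSeries (Polynomial ℝ)) (n : ℕ) :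
    posNumerator φ z q (-n) = (1 + φ ^ 2) * (1 - z * q * φ) * φ ^ n := by
  simp [posNumerator]

lemma posNumerator_zero (φ z q : PowerSeries (Polynomial ℝ)) :
    posNumerator φ z q 0 = (1 + φ ^ 2) * (1 - z * q * φ) := by
  simp [posNumerator]

lemma posNumerator_one (φ z q : PowerSeries (Polynomial ℝ)) :
    posNumerator φ z q 1 = q * φ := by
  simp [posNumerator]

lemma posNumerator_add_two (φ z q : PowerSeries (Polynomial ℝ)) (n : ℕ) :
    posNumerator φ z q ((n + 2 : ℕ) : ℤ) = q ^ 2 * φ ^ (n + 2) := by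
  have h1 : ¬ ((n + 2 : ℕ) : ℤ) ≤ 0 := by omega
  have h2 : ¬ ((n + 2 : ℕ) : ℤ) = 1 := by omega
  rw [posNumerator, if_neg h1, if_neg h2, Int.toNat_natCast]

lemma posNumerator_eq {φ z q : PowerSeries (Polynomial ℝ)} (hφ : φ = z * (1 + φ ^ 2))
    (hq : q = C (1 + Polynomial.X)) (x : ℤ) :
    posNumerator φ z q x = (if x = 0 then 1 - 2 * z * q * φ else 0) +
      z * (C (stepWeight x) * posNumerator φ z q (x - 1) + posNumerator φ z q (x + 1)) := by
  have hw : ∀ y : ℤ, y = 1 ∨ y = 2 → C (stepWeight y) = q := fun y hy => by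
    rw [stepWeight, if_pos hy, hq]
  have hw' : ∀ y : ℤ, ¬ (y = 1 ∨ y = 2) → C (stepWeight y) = 1 := fun y hy => by
    rw [stepWeight, if_neg hy, map_one]
  rcases lt_trichotomy x 0 with hx | rfl | hx
  · obtain ⟨n, rfl⟩ : ∃ n : ℕ, x = -((n + 1 : ℕ) : ℤ) := ⟨(-x - 1).toNat, by omega⟩
    rw [if_neg (by omega), hw' _ (by omega),
      show -((n + 1 : ℕ) : ℤ) - 1 = -((n + 2 : ℕ) : ℤ) by push_cast; ring,
      show -((n + 1 : ℕ) : ℤ) + 1 = -(n : ℤ) by push_cast; ring]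
    simp only [posNumerator_neg]
    linear_combination (1 + φ ^ 2) * (1 - z * q * φ) * φ ^ n * hφ
  · rw [if_pos rfl, hw' _ (by omega), zero_add, posNumerator_one, posNumerator_zero,
      show (0 : ℤ) - 1 = -((1 : ℕ) : ℤ) by norm_num, posNumerator_neg]
    linear_combination (1 - z * q * φ) * φ * hφ
  · obtain ⟨n, rfl⟩ : ∃ n : ℕ, x = ((n + 1 : ℕ) : ℤ) := ⟨(x - 1).toNat, by omega⟩
    rw [if_neg (by omega),
      show ((n + 1 : ℕ) : ℤ) + 1 = ((n + 2 : ℕ) : ℤ) by push_cast; ring, posNumerator_add_two]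
    rcases n with _ | _ | n
    · rw [hw _ (by omega), zero_add, Nat.cast_one, sub_self, posNumerator_zero, posNumerator_one]
      linear_combination q * (1 - z * q * φ) * hφ
    · rw [hw _ (by omega), show ((0 + 1 + 1 : ℕ) : ℤ) - 1 = 1 by norm_num, posNumerator_one,
        show 0 + 1 + 1 = 0 + 2 by norm_num, posNumerator_add_two]
      linear_combination q ^ 2 * φ * hφ
    · rw [hw' _ (by omega),
        show ((n + 1 + 1 + 1 : ℕ) : ℤ) - 1 = ((n + 2 : ℕ) : ℤ) by push_cast; ring,
        show n + 1 + 1 + 1 = (n + 1) + 2 by ring, posNumerator_add_two, posNumerator_add_two]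
      linear_combination q ^ 2 * φ ^ (n + 2) * hφ

lemma mul_posSeries {φ : PowerSeries ℝ} (hφ : φ = halfX * (1 + φ ^ 2)) (x : ℤ) :
    (1 - 2 * map Polynomial.C halfX * C (1 + Polynomial.X) * map Polynomial.C φ) * posSeries x
      = posNumerator (map Polynomial.C φ) (map Polynomial.C halfX) (C (1 + Polynomial.X)) x := by
  have hφ' := congrArg (map (Polynomial.C (R := ℝ))) hφ
  simp only [map_mul, map_add, map_one, map_pow (map (Polynomial.C (R := ℝ)))] at hφ'
  set f := map (Polynomial.C (R := ℝ)) φ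
  set q : PowerSeries (Polynomial ℝ) := C (1 + Polynomial.X) with hq
  set z := map (Polynomial.C (R := ℝ)) halfX with hz
  have h := eq_zero_of_eq_X_mul
    (fun y => (1 - 2 * z * q * f) * posSeries y - posNumerator f z q y)
    (fun y => C (Polynomial.C (1 / 2 : ℝ)) * C (stepWeight y))
    (fun _ => C (Polynomial.C (1 / 2 : ℝ))) (fun y => ?_) x
  · exact sub_eq_zero.1 h
  · have h1 := posSeries_eq y
    have h2 := posNumerator_eq hφ' hq y
    rw [← hz] at h1
    have h3 : z = X * C (Polynomial.C (1 / 2 : ℝ)) := map_halfX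
    have h4 : (if y = 0 then 1 - 2 * z * q * f else 0) =
      (1 - 2 * z * q * f) * (if y = 0 then 1 else 0) := by split_ifs <;> ring
    rw [h4] at h2
    linear_combination (1 - 2 * z * q * f) * h1 - h2 + (C (stepWeight y) *
      ((1 - 2 * z * q * f) * posSeries (y - 1) - posNumerator f z q (y - 1)) +
      ((1 - 2 * z * q * f) * posSeries (y + 1) - posNumerator f z q (y + 1))) * h3

/-- The coefficient of `u ^ k` in a series over polynomials in `u`. -/
noncomputable def innerCoeff (k : ℕ) (F : PowerSeries (Polynomial ℝ)) : PowerSeries ℝ :=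
  PowerSeries.mk fun m => (coeff m F).coeff k

lemma innerCoeff_add (k : ℕ) (F G : PowerSeries (Polynomial ℝ)) :
    innerCoeff k (F + G) = innerCoeff k F + innerCoeff k G := by
  ext1; simp [innerCoeff]

lemma innerCoeff_map_mul (k : ℕ) (a : PowerSeries ℝ) (F : PowerSeries (Polynomial ℝ)) :
    innerCoeff k (map Polynomial.C a * F) = a * innerCoeff k F := by
  ext1; simp [innerCoeff, coeff_mul]

lemma innerCoeff_zero_map (a : PowerSeries ℝ) : innerCoeff 0 (map Polynomial.C a) = a := by
  ext1; simp [innerCoeff]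

lemma innerCoeff_succ_map (k : ℕ) (a : PowerSeries ℝ) :
    innerCoeff (k + 1) (map Polynomial.C a) = 0 := by
  ext1; simp [innerCoeff]

lemma innerCoeff_zero_C_X_mul (F : PowerSeries (Polynomial ℝ)) :
    innerCoeff 0 (C Polynomial.X * F) = 0 := by
  ext1; simp [innerCoeff]

lemma innerCoeff_succ_C_X_mul (k : ℕ) (F : PowerSeries (Polynomial ℝ)) :
    innerCoeff (k + 1) (C Polynomial.X * F) = innerCoeff k F := by
  ext1; simp [innerCoeff]

lemma one_sub_X_mul_totalSeries_eq {φ : PowerSeries ℝ} (hφ : φ = halfX * (1 + φ ^ 2))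
    (hR : rootSeries * (1 - 2 * halfX * φ) = 1) :
    (1 - X) * totalSeries = 1 + C Polynomial.X * (map Polynomial.C (rootSeries - 1) *
      ((1 - X) * totalSeries)
      + (map Polynomial.C (1 - rootSeries + rootSeries * φ * (1 + halfX * (1 - φ)))
      + C Polynomial.X * map Polynomial.C (rootSeries * φ * halfX * (1 - φ)))) := by
  have h0 := mul_posSeries hφ 0
  have h1 := mul_posSeries hφ 1
  have hT := one_sub_X_mul_totalSeries
  rw [posNumerator_zero] at h0
  rw [posNumerator_one] at h1
  have hφ' := congrArg (map (Polynomial.C (R := ℝ))) hφ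
  have hR' := congrArg (map (Polynomial.C (R := ℝ))) hR
  simp only [map_mul, map_add, map_sub, map_one, map_pow, map_ofNat] at hφ' hR' h0 h1 ⊢
  set f := map (Polynomial.C (R := ℝ)) φ
  set R := map (Polynomial.C (R := ℝ)) rootSeries
  set z := map (Polynomial.C (R := ℝ)) halfX
  set u : PowerSeries (Polynomial ℝ) := C Polynomial.X
  generalize (1 - X) * totalSeries = J at *
  have h2 : R * (1 - 2 * z * (1 + u) * f) * J = R * (1 - 2 * z * (1 + u) * f)
      + u * (R * f * (1 - z * (1 + u) * f) + R * z * (1 + u) * f) := by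
    linear_combination (R * (1 - 2 * z * (1 + u) * f)) * hT + R * u * z * (h0 + h1)
      - R * u * (1 - z * (1 + u) * f) * hφ'
  linear_combination h2 + (-(1 + u) * J + (1 + u)) * hR'

end Bivariate

section Limits

open PowerSeries Filter Topology

lemma innerCoeff_succ_totalSeries {φ : PowerSeries ℝ} (hφ : φ = halfX * (1 + φ ^ 2))
    (hR : rootSeries * (1 - 2 * halfX * φ) = 1) (k : ℕ) :
    (1 - X) * innerCoeff (k + 1) totalSeries
      = (rootSeries - 1) * ((1 - X) * innerCoeff k totalSeries)
        + ((if k = 0 then 1 - rootSeries + rootSeries * φ * (1 + halfX * (1 - φ)) else 0)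
        + if k = 1 then rootSeries * φ * halfX * (1 - φ) else 0) := by
  have hX : ∀ j F, innerCoeff j ((1 - X) * F) = (1 - X) * innerCoeff j F := fun j F => by
    rw [← innerCoeff_map_mul, map_sub, map_one, map_X]
  have h1 : innerCoeff (k + 1) 1 = 0 := by
    rw [← innerCoeff_succ_map k 1, map_one]
  rw [← hX, one_sub_X_mul_totalSeries_eq hφ hR, innerCoeff_add, h1, zero_add,
    innerCoeff_succ_C_X_mul, innerCoeff_add, innerCoeff_map_mul, innerCoeff_add, hX]
  generalize 1 - rootSeries + rootSeries * φ * (1 + halfX * (1 - φ)) = A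
  generalize rootSeries * φ * halfX * (1 - φ) = B
  match k with
  | 0 => simp [innerCoeff_zero_map, innerCoeff_zero_C_X_mul]
  | 1 => simp [innerCoeff_zero_map, innerCoeff_succ_map, innerCoeff_succ_C_X_mul]
  | k + 2 => simp [innerCoeff_succ_map, innerCoeff_succ_C_X_mul]

lemma one_sub_X_mul_innerCoeff_zero : (1 - X) * innerCoeff 0 totalSeries = 1 := by
  have h := congrArg (innerCoeff 0) one_sub_X_mul_totalSeries
  have h1 : innerCoeff 0 1 = 1 := by rw [← innerCoeff_zero_map 1, map_one]
  have hX : map Polynomial.C (1 - X : PowerSeries ℝ) = 1 - X := by rw [map_sub, map_one, map_X]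
  rwa [innerCoeff_add, innerCoeff_zero_C_X_mul, add_zero, ← hX, innerCoeff_map_mul, h1] at h

lemma coeffAsymp_innerCoeff_totalSeries (k : ℕ) :
    CoeffAsymp (innerCoeff k totalSeries) ((k : ℝ) / 2) (limitConst k) := by
  obtain ⟨φ, hφ2, hR2, hφX⟩ := exists_passage_series
  have h2 := two_mul_halfX
  have htwo : (2 : PowerSeries ℝ) ≠ 0 := fun h => by
    have h1 := congrArg constantCoeff h
    rw [map_ofNat, map_zero] at h1
    exact two_ne_zero h1
  have hφ : φ = halfX * (1 + φ ^ 2) := by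
    refine mul_left_cancel₀ htwo ?_
    linear_combination hφ2 - (1 + φ ^ 2) * h2
  have hR : rootSeries * (1 - 2 * halfX * φ) = 1 := by
    rw [h2, hR2]
  have hU := one_sub_X_mul_riseSeries_zero
  have hX1 : (1 - X : PowerSeries ℝ) ≠ 0 := left_ne_zero_of_mul_eq_one hU
  have hhalf : ∀ F : PowerSeries ℝ, 2 * ((1 / 2 : ℝ) • F) = F := fun F => by
    rw [two_mul, ← add_smul]
    norm_num
  have hmark : ∀ j, 2 * ((1 - X) * (rootSeries * (rootSeries - 1) ^ j * riseSeries 0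
      - (1 / 2 : ℝ) • ((rootSeries - 1) ^ j * riseSeries 0)
      - (1 / 2 : ℝ) • ((1 - X) * (rootSeries * (rootSeries - 1) ^ j * riseSeries 0))))
      = (rootSeries - 1) ^ j * ((1 + X) * rootSeries - 1) := fun j => by
    have e1 := hhalf ((rootSeries - 1) ^ j * riseSeries 0)
    have e2 := hhalf ((1 - X) * (rootSeries * (rootSeries - 1) ^ j * riseSeries 0))
    linear_combination (-(1 - X)) * (e1 + e2)
      + (rootSeries - 1) ^ j * ((1 + X) * rootSeries - 1) * hU
  have hJ1 : 2 * ((1 - X) * innerCoeff 1 totalSeries) = (1 + X) * rootSeries - 1 := by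
    have h := innerCoeff_succ_totalSeries hφ hR 0
    rw [one_sub_X_mul_innerCoeff_zero, if_pos rfl, if_neg zero_ne_one, zero_add] at h
    linear_combination 2 * h + 2 * rootSeries * hφ - hR + rootSeries * h2
  have hJ : ∀ j, 2 * ((1 - X) * (X * innerCoeff (j + 2) totalSeries))
      = (rootSeries - 1) ^ (j + 1) * ((1 + X) * rootSeries - 1) := fun j => by
    induction j with
    | zero =>
      have h := innerCoeff_succ_totalSeries hφ hR 1
      rw [if_neg one_ne_zero, if_pos rfl] at h
      linear_combination 2 * X * h + X * (rootSeries - 1) * hJ1 - X * (1 - φ) * hR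
        - (rootSeries - 1) * hφX
    | succ j ih =>
      have h := innerCoeff_succ_totalSeries hφ hR (j + 2)
      rw [if_neg (by omega), if_neg (by omega)] at h
      linear_combination 2 * X * h + (rootSeries - 1) * ih
  match k with
  | 0 =>
    have h0 : innerCoeff 0 totalSeries = riseSeries 0 :=
      mul_left_cancel₀ hX1 (by rw [hU, one_sub_X_mul_innerCoeff_zero])
    simpa [h0] using coeffAsymp_rootSeries_pow 0 0
  | 1 =>
    have h := coeffAsymp_marked 0
    have e : 2 * ((1 - X) * innerCoeff 1 totalSeries)
        = (rootSeries - 1) ^ 0 * ((1 + X) * rootSeries - 1) := by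
      rw [hJ1, pow_zero, one_mul]
    rw [mul_left_cancel₀ hX1 (mul_left_cancel₀ htwo ((hmark 0).trans e.symm))] at h
    simpa using h
  | k + 2 =>
    have h := coeffAsymp_marked (k + 1)
    rw [mul_left_cancel₀ hX1 (mul_left_cancel₀ htwo ((hmark (k + 1)).trans (hJ k).symm))] at h
    exact h.of_X_mul

lemma tendsto_coeff_walkTotal (k : ℕ) :
    Tendsto (fun m : ℕ => (walkTotal m).coeff k / (m : ℝ) ^ ((k : ℝ) / 2)) atTop
      (𝓝 (limitConst k)) := by
  simpa [CoeffAsymp, innerCoeff, totalSeries] using coeffAsymp_innerCoeff_totalSeries k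

lemma tsum_descFactorial_mul_coeff (p : Polynomial ℝ) (s : ℕ) :
    ∑' k : ℕ, (k.descFactorial s : ℝ) * p.coeff k
      = (s.factorial : ℝ) * (Polynomial.taylor 1 p).coeff s := by
  rw [Polynomial.taylor_coeff, Polynomial.hasseDeriv_apply, Polynomial.sum_def,
    Polynomial.eval_finsetSum, Finset.mul_sum, tsum_eq_sum (s := p.support)]
  · refine Finset.sum_congr rfl fun k _ => ?_
    rw [Nat.descFactorial_eq_factorial_mul_choose]
    simp
    ring
  · intro k hk
    rw [Polynomial.notMem_support_iff.1 hk, mul_zero]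

/-- The polynomial by which `fP` differs from a product of two sums. -/
noncomputable def correction : Polynomial ℝ :=
  4 * Polynomial.X ^ 4 - 2 * (Polynomial.X ^ 2 + Polynomial.X ^ 3)

lemma taylor_fP (n : ℕ) :
    Polynomial.taylor 1 (fP n) = Polynomial.taylor 1 correction + Polynomial.C (2 ^ n) *
      (walkTotal ((n + 1) / 2) * walkTotal (n - (n + 1) / 2)) := by
  have hn : (n + 1) / 2 + (n - (n + 1) / 2) = n := by omega
  rw [fP, ← Finset.sum_mul_sum, map_add, Polynomial.taylor_mul, taylor_sum_gP, taylor_sum_gP,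
    ← correction]
  have h2 : (2 : ℝ) ^ n = 2 ^ ((n + 1) / 2) * 2 ^ (n - (n + 1) / 2) := by rw [← pow_add, hn]
  rw [h2, Polynomial.C_mul]
  ring

lemma tendsto_coeff_walkTotal_comp {u : ℕ → ℕ} (hu : Tendsto u atTop atTop)
    (hu2 : Tendsto (fun n => (u n : ℝ) / n) atTop (𝓝 (1 / 2))) (k : ℕ) :
    Tendsto (fun n : ℕ => (walkTotal (u n)).coeff k / (n : ℝ) ^ ((k : ℝ) / 2)) atTop
      (𝓝 (limitConst k * (1 / 2) ^ ((k : ℝ) / 2))) := by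
  have h1 := (tendsto_coeff_walkTotal k).comp hu
  have h2 := hu2.rpow_const (p := (k : ℝ) / 2) (Or.inl (by norm_num))
  refine (h1.mul h2).congr' ?_
  filter_upwards [hu.eventually_gt_atTop 0, eventually_gt_atTop 0] with n hn hn'
  have hn1 : (0 : ℝ) < u n := by exact_mod_cast hn
  have hn2 : (0 : ℝ) < n := by exact_mod_cast hn'
  have := Real.rpow_pos_of_pos hn1 ((k : ℝ) / 2)
  have := Real.rpow_pos_of_pos hn2 ((k : ℝ) / 2)
  simp only [Function.comp]
  rw [Real.div_rpow hn1.le hn2.le]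
  field_simp

lemma factorial_mul_limitConst (k : ℕ) :
    (k.factorial : ℝ) * (limitConst k * (1 / 2) ^ ((k : ℝ) / 2))
      = Real.Gamma (((k : ℝ) + 1) / 2) / √Real.pi := by
  have h := Real.Gamma_mul_Gamma_add_half (((k : ℝ) + 1) / 2)
  have hΓ : 0 < Real.Gamma ((k : ℝ) / 2 + 1) := Real.Gamma_pos_of_pos (by positivity)
  have hπ : 0 < √Real.pi := Real.sqrt_pos.2 Real.pi_pos
  rw [show ((k : ℝ) + 1) / 2 + 1 / 2 = k / 2 + 1 by ring,
    show 2 * (((k : ℝ) + 1) / 2) = k + 1 by ring, Real.Gamma_nat_eq_factorial,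
    show (1 : ℝ) - (k + 1) = -k by ring] at h
  have h2 : (1 / 2 : ℝ) ^ ((k : ℝ) / 2) * (1 / 2 : ℝ) ^ ((k : ℝ) / 2) = 2 ^ (-(k : ℝ)) := by
    rw [← Real.rpow_add (by norm_num), add_halves, one_div, Real.inv_rpow (by norm_num),
      Real.rpow_neg (by norm_num)]
  rw [limitConst, div_mul_eq_mul_div, h2]
  generalize Real.Gamma ((k : ℝ) / 2 + 1) = a at *
  rw [← mul_div_assoc, div_eq_div_iff hΓ.ne' hπ.ne', h]

lemma factorial_mul_sum_limitConst (s : ℕ) :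
    (s.factorial : ℝ) * ∑ p ∈ Finset.HasAntidiagonal.antidiagonal s,
      (limitConst p.1 * (1 / 2) ^ ((p.1 : ℝ) / 2)) * (limitConst p.2 * (1 / 2) ^ ((p.2 : ℝ) / 2))
      = mutilde s := by
  rw [Finset.Nat.sum_antidiagonal_eq_sum_range_succ_mk, mutilde, Finset.mul_sum]
  refine Finset.sum_congr rfl fun k hk => ?_
  have hks : k ≤ s := by simpa [Nat.lt_succ_iff] using hk
  have h1 := factorial_mul_limitConst k
  have h2 := factorial_mul_limitConst (s - k)
  have h3 : (s.choose k : ℝ) * k.factorial * (s - k).factorial = s.factorial := by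
    exact_mod_cast Nat.choose_mul_factorial_mul_factorial hks
  simp only
  rw [← h3]
  rw [Nat.cast_sub hks] at h2 ⊢
  have h4 : √Real.pi * √Real.pi = Real.pi := Real.mul_self_sqrt Real.pi_pos.le
  calc _ = (s.choose k : ℝ) * ((k.factorial : ℝ) * (limitConst k * (1 / 2) ^ ((k : ℝ) / 2))) *
        (((s - k).factorial : ℝ) * (limitConst (s - k) * (1 / 2) ^ (((s : ℝ) - k) / 2))) := by ring
    _ = _ := by
      rw [h1, h2, mul_assoc, div_mul_div_comm, h4]
      ring

end Limits

open Filter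

theorem stmt7 (s : ℕ) (hs : 1 ≤ s) :
    Tendsto (fun n : ℕ =>
        ((1 / 2 ^ n : ℝ) * ∑' k : ℕ, (k.descFactorial s : ℝ) * (fP n).coeff k)
          / (n : ℝ) ^ ((s : ℝ) / 2))
      atTop (nhds (mutilde s)) := by
  have hhalf : Tendsto (fun n : ℕ => (((n + 1) / 2 : ℕ) : ℝ) / n) atTop (nhds (1 / 2)) := by
    have h := ((tendsto_add_atTop_iff_nat 1).2 tendsto_half_div).mul
      (CoeffAsymp.tendsto_succ_rpow_div 1)
    rw [mul_one] at h
    refine h.congr fun n => ?_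
    rw [Real.rpow_one, Real.rpow_one, div_mul_div_cancel₀ (by positivity)]
  have hhalf' : Tendsto (fun n : ℕ => ((n - (n + 1) / 2 : ℕ) : ℝ) / n) atTop (nhds (1 / 2)) := by
    refine tendsto_half_div.congr fun n => ?_
    rw [show n - (n + 1) / 2 = n / 2 by omega]
  have hu : Tendsto (fun n : ℕ => (n + 1) / 2) atTop atTop :=
    tendsto_atTop.2 fun b => by
      filter_upwards [eventually_ge_atTop (2 * b)] with n hn
      omega
  have hv : Tendsto (fun n : ℕ => n - (n + 1) / 2) atTop atTop :=
    tendsto_atTop.2 fun b => by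
      filter_upwards [eventually_ge_atTop (2 * b)] with n hn
      omega
  have hmain := (tendsto_finsetSum (Finset.HasAntidiagonal.antidiagonal s) fun p _ =>
    (tendsto_coeff_walkTotal_comp hu hhalf p.1).mul
      (tendsto_coeff_walkTotal_comp hv hhalf' p.2)).const_mul (s.factorial : ℝ)
  rw [factorial_mul_sum_limitConst] at hmain
  have hpow : Tendsto (fun n : ℕ => (1 / 2 : ℝ) ^ n) atTop (nhds 0) :=
    tendsto_pow_atTop_nhds_zero_of_lt_one (by norm_num) (by norm_num)
  have hneg : Tendsto (fun n : ℕ => (n : ℝ) ^ (-((s : ℝ) / 2))) atTop (nhds 0) :=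
    (tendsto_rpow_neg_atTop (by positivity)).comp tendsto_natCast_atTop_atTop
  have hcorr := (hpow.mul hneg).const_mul
    ((s.factorial : ℝ) * (Polynomial.taylor 1 correction).coeff s)
  have hsum := hcorr.add hmain
  rw [mul_zero, mul_zero, zero_add] at hsum
  refine hsum.congr' ?_
  filter_upwards [eventually_gt_atTop 0] with n hn
  have hn' : (0 : ℝ) < n := by exact_mod_cast hn
  have hprod : ∑ p ∈ Finset.HasAntidiagonal.antidiagonal s,
      (walkTotal ((n + 1) / 2)).coeff p.1 / (n : ℝ) ^ ((p.1 : ℝ) / 2) *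
        ((walkTotal (n - (n + 1) / 2)).coeff p.2 / (n : ℝ) ^ ((p.2 : ℝ) / 2))
      = (walkTotal ((n + 1) / 2) * walkTotal (n - (n + 1) / 2)).coeff s
        / (n : ℝ) ^ ((s : ℝ) / 2) := by
    rw [Polynomial.coeff_mul, Finset.sum_div]
    refine Finset.sum_congr rfl fun p hp => ?_
    rw [div_mul_div_comm, ← Real.rpow_add hn', ← add_div]
    have : p.1 + p.2 = s := by simpa using hp
    rw [← this, Nat.cast_add]
  rw [hprod, tsum_descFactorial_mul_coeff, taylor_fP, Polynomial.coeff_add, Polynomial.coeff_C_mul,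
    Real.rpow_neg hn'.le, div_pow, one_pow]
  field_simp
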